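/- arXiv:1305.6441 — 2 statements merged into one kernel-verified Lean document; each statement's English description precedes it below -/
import Mathlib

section
/- Let V be a finite nonempty type and r : V → V → Prop a relation (the arcs of a digraph). Write R = Relation.ReflTransGen r for reachability. Call U ⊆ V a vertex basis if every v ∈ V is reachable from some u ∈ U and no proper subset of U has this property. Call K ⊆ V a source knot if K is nonempty, any two vertices of K are mutually R-reachable, and every vertex x with R x v for some v ∈ K belongs to K. Then U is a vertex basis if and only if U contains exactly one vertex from each source knot and no other vertices, i.e., for every source knot K there is exactly one element of U ∩ K, and every element of U lies in some source knot. -/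
/-- In a finite digraph every vertex is reachable from a vertex which reaches all of its
ancestors. -/
theorem exists_reflTransGen_source {V : Type*} [Finite V] (r : V → V → Prop) (v : V) :
    ∃ m, Relation.ReflTransGen r m v ∧
      ∀ x, Relation.ReflTransGen r x m → Relation.ReflTransGen r m x := by
  let _ : Preorder V :=
    { le := Relation.ReflTransGen r
      le_refl := fun _ => .refl
      le_trans := fun _ _ _ => .trans }
  obtain ⟨m, hmv, hm⟩ := (Set.toFinite (Set.univ : Set V)).exists_le_minimal (Set.mem_univ v)
  exact ⟨m, hmv, fun x hx => hm.2 (Set.mem_univ x) hx⟩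

/-- Distinct vertices of a minimal covering set do not reach each other. -/
theorem eq_of_reflTransGen_of_minimal_cover {V : Type*} {r : V → V → Prop} {U : Set V}
    (hU : ∀ v, ∃ u ∈ U, Relation.ReflTransGen r u v)
    (hmin : ∀ U' : Set V, U' ⊂ U → ¬(∀ v, ∃ u ∈ U', Relation.ReflTransGen r u v))
    {a b : V} (ha : a ∈ U) (hb : b ∈ U) (hab : Relation.ReflTransGen r a b) : a = b := by
  by_contra hne
  refine hmin (U \ {b}) ⟨Set.sdiff_subset, fun h => (h hb).2 rfl⟩ fun v => ?_
  obtain ⟨u, hu, huv⟩ := hU v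
  by_cases hub : u = b
  · subst hub
    exact ⟨a, ⟨ha, hne⟩, hab.trans huv⟩
  · exact ⟨u, ⟨hu, hub⟩, huv⟩

/-- A set `U` is a vertex basis of a digraph iff it contains exactly one vertex from each
source knot and no other vertices. -/
theorem vertex_basis_iff_source_knots {V : Type*} [Fintype V] [Nonempty V]
    (r : V → V → Prop) (U : Set V) :
    ((∀ v : V, ∃ u ∈ U, Relation.ReflTransGen r u v) ∧
      ∀ U' : Set V, U' ⊂ U → ¬(∀ v : V, ∃ u ∈ U', Relation.ReflTransGen r u v)) ↔
    ((∀ K : Set V,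
        (K.Nonempty ∧
          (∀ x ∈ K, ∀ y ∈ K, Relation.ReflTransGen r x y) ∧
          (∀ x v, v ∈ K → Relation.ReflTransGen r x v → x ∈ K)) →
        ∃! u, u ∈ U ∩ K) ∧
      ∀ u ∈ U, ∃ K : Set V,
        (K.Nonempty ∧
          (∀ x ∈ K, ∀ y ∈ K, Relation.ReflTransGen r x y) ∧
          (∀ x v, v ∈ K → Relation.ReflTransGen r x v → x ∈ K)) ∧ u ∈ K) := by
  constructor
  · rintro ⟨hU, hmin⟩
    refine ⟨?_, fun u hu => ?_⟩
    · rintro K ⟨⟨k, hk⟩, hconn, hclosed⟩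
      obtain ⟨u, hu, huk⟩ := hU k
      have huK := hclosed u k hk huk
      exact ⟨u, ⟨hu, huK⟩, fun w hw =>
        eq_of_reflTransGen_of_minimal_cover hU hmin hw.1 hu (hconn w hw.2 u huK)⟩
    · refine ⟨{x | Relation.ReflTransGen r x u},
        ⟨⟨u, .refl⟩, fun x hx y hy => ?_, fun x v hv hxv => hxv.trans hv⟩, .refl⟩
      obtain ⟨w, hw, hwy⟩ := hU y
      obtain rfl := eq_of_reflTransGen_of_minimal_cover hU hmin hw hu (hwy.trans hy)
      exact Relation.ReflTransGen.trans hx hwy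
  · rintro ⟨hknot, hmem⟩
    refine ⟨fun v => ?_, fun U' hU' hcover => ?_⟩
    · obtain ⟨m, hmv, hm⟩ := exists_reflTransGen_source r v
      obtain ⟨u, ⟨hu, hum⟩, -⟩ := hknot {x | Relation.ReflTransGen r x m}
        ⟨⟨m, .refl⟩, fun x hx y hy => Relation.ReflTransGen.trans hx (hm y hy),
          fun x v hv hxv => hxv.trans hv⟩
      exact ⟨u, hu, Relation.ReflTransGen.trans hum hmv⟩
    · obtain ⟨u, hu, hu'⟩ := Set.exists_of_ssubset hU'
      obtain ⟨K, hK, huK⟩ := hmem u hu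
      obtain ⟨w, hw, hwu⟩ := hcover u
      obtain rfl := (hknot K hK).unique ⟨hU'.1 hw, hK.2.2 w u huK hwu⟩ ⟨hu, huK⟩
      exact hu' hw
end

section
/- Let V be a finite nonempty type and A : Matrix V V ℝ a matrix all of whose column sums are zero (∑_i A i j = 0 for every j). Then every row of the adjugate of A is constant: for every i and all j, k, (adjugate A) i j = (adjugate A) i k. Equivalently, the cofactor of the (i,j) entry of A does not depend on the row index i. -/
open Matrix

theorem det_eq_zero_of_column_sums_zero {V R : Type*} [Fintype V] [DecidableEq V] [Nonempty V]
    [CommRing R] [IsDomain R] (A : Matrix V V R) (hA : ∀ j, ∑ i, A i j = 0) : A.det = 0 := by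
  refine exists_vecMul_eq_zero_iff.mp ⟨1, one_ne_zero, ?_⟩
  ext j
  simpa [vecMul, dotProduct] using hA j

/-- If all column sums of `A` vanish, then every row of `adjugate A` is constant. -/
theorem adjugate_row_constant_of_column_sums_zero {V : Type*} [Fintype V] [DecidableEq V]
    [Nonempty V] (A : Matrix V V ℝ) (hA : ∀ j, ∑ i, A i j = 0) :
    ∀ i j k, A.adjugate i j = A.adjugate i k := by
  intro i j k
  have h : A.cramer (Pi.single j 1 - Pi.single k 1) i = 0 := by
    rw [cramer_apply]
    refine det_eq_zero_of_column_sums_zero _ fun l => ?_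
    obtain rfl | hl := eq_or_ne l i
    · simp
    · simp [updateCol_ne hl, hA]
  rw [cramer_eq_adjugate_mulVec, mulVec_sub] at h
  simpa [sub_eq_zero] using h
end
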